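/- Let U and V be independent random vectors, each uniformly distributed on the ball v(r) = {x ∈ ℝ^d : ‖x‖ < r}. Then the probability density function of the distance ‖U−V‖ is ψ(ρ) = d ρ^{d−1} r^{−d} I_{1−(ρ/2r)²}((d+1)/2, 1/2) for 0 ≤ ρ ≤ 2r, where I_μ(p,q) is the regularized incomplete beta function. -/

import Mathlib

open MeasureTheory ProbabilityTheory

/-- The regularized incomplete beta function. -/
noncomputable def regIncBeta (μ p q : ℝ) : ℝ :=
  Real.Gamma (p + q) / (Real.Gamma p * Real.Gamma q) *
    ∫ t in (0 : ℝ)..μ, t ^ (p - 1) * (1 - t) ^ (q - 1)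

open Set Metric
open scoped ENNReal

/-- Integration of a radial function in polar coordinates. -/
theorem lintegral_fun_norm_addHaar {E : Type*} [NormedAddCommGroup E] [NormedSpace ℝ E]
    [FiniteDimensional ℝ E] [Nontrivial E] [MeasurableSpace E] [BorelSpace E]
    (μ : Measure E) [μ.IsAddHaarMeasure] {f : ℝ → ℝ≥0∞} (hf : Measurable f) :
    ∫⁻ x, f ‖x‖ ∂μ = Module.finrank ℝ E * μ (ball 0 1) *
      ∫⁻ y in Ioi (0 : ℝ), ENNReal.ofReal (y ^ (Module.finrank ℝ E - 1)) * f y := by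
  calc
    ∫⁻ x, f ‖x‖ ∂μ = ∫⁻ x : ({0}ᶜ : Set E), f ‖x.1‖ ∂(μ.comap (↑)) := by
      rw [lintegral_subtype_comap (measurableSet_singleton _).compl fun x ↦ f ‖x‖,
        restrict_compl_singleton]
    _ = ∫⁻ x, f x.2 ∂μ.toSphere.prod (.volumeIoiPow (Module.finrank ℝ E - 1)) := by
      simpa using μ.measurePreserving_homeomorphUnitSphereProd.lintegral_comp
        (f := fun x ↦ f x.2) (by fun_prop)
    _ = _ := by
      rw [lintegral_prod _ (by fun_prop)]
      simp only [lintegral_const]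
      rw [Measure.toSphere_apply_univ, Measure.volumeIoiPow,
        lintegral_withDensity_eq_lintegral_mul _ (by fun_prop) (by fun_prop),
        mul_comm]
      congr 1
      exact lintegral_subtype_comap measurableSet_Ioi
        fun y ↦ ENNReal.ofReal (y ^ (Module.finrank ℝ E - 1)) * f y

theorem volume_sum_sq_lt (n : ℕ) {a : ℝ} (ha : 0 < a) :
    volume {y : Fin n → ℝ | ∑ i, y i ^ 2 < a} =
      ENNReal.ofReal (√Real.pi ^ n / Real.Gamma (n / 2 + 1) * a ^ ((n : ℝ) / 2)) := by
  have key : {y : Fin n → ℝ | ∑ i, y i ^ 2 < a} =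
      (WithLp.toLp 2) ⁻¹' (ball (0 : EuclideanSpace ℝ (Fin n)) √a) := by
    ext y
    simp [EuclideanSpace.ball_zero_eq _ (Real.sqrt_nonneg a), Real.sq_sqrt ha.le]
  rw [key, (PiLp.volume_preserving_toLp (Fin n)).measure_preimage
    measurableSet_ball.nullMeasurableSet]
  rcases n.eq_zero_or_pos with rfl | hn
  · rw [volume_euclideanSpace_eq_dirac, Measure.dirac_apply' _ measurableSet_ball]
    simp [ha]
  · have : Nonempty (Fin n) := ⟨⟨0, hn⟩⟩
    rw [EuclideanSpace.volume_ball, ← ENNReal.ofReal_pow (Real.sqrt_nonneg a),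
      ← ENNReal.ofReal_mul (by positivity), mul_comm, Fintype.card_fin, Real.sqrt_eq_rpow a,
      ← Real.rpow_natCast (a ^ _), ← Real.rpow_mul ha.le, one_div_mul_eq_div]

theorem lintegral_comp_abs {f : ℝ → ℝ≥0∞} :
    ∫⁻ x, f |x| = 2 * ∫⁻ x in Ioi (0 : ℝ), f x := by
  have h1 : ∫⁻ x in Ioi (0 : ℝ), f |x| = ∫⁻ x in Ioi (0 : ℝ), f x :=
    setLIntegral_congr_fun measurableSet_Ioi fun x hx => by rw [abs_of_pos hx]
  have h2 : ∫⁻ x in Iic (0 : ℝ), f |x| = ∫⁻ x in Ioi (0 : ℝ), f x := by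
    rw [← h1, setLIntegral_congr Iio_ae_eq_Iic.symm]
    have := (Measure.measurePreserving_neg (volume : Measure ℝ)).setLIntegral_comp_preimage_emb
      (MeasurableEquiv.neg ℝ).measurableEmbedding (fun x => f |x|) (Ioi 0)
    simpa using this
  rw [← lintegral_add_compl _ measurableSet_Ioi, compl_Ioi, h1, h2, two_mul]

/-- Substituting `x = r √(1 - t)`. -/
theorem lintegral_sub_sq_rpow {r s : ℝ} (hr : 0 < r) (hs : 0 ≤ s) (a : ℝ) :
    ∫⁻ x in Ioo s r, ENNReal.ofReal ((r ^ 2 - x ^ 2) ^ a) =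
      ENNReal.ofReal (r ^ (2 * a + 1) / 2) *
        ∫⁻ t in Ioo 0 (1 - (s / r) ^ 2), ENNReal.ofReal (t ^ a * (1 - t) ^ (-(1 / 2) : ℝ)) := by
  have himg : (fun t => r * √(1 - t)) '' Ioo 0 (1 - (s / r) ^ 2) = Ioo s r := by
    ext x
    constructor
    · rintro ⟨t, ⟨h0, h1⟩, rfl⟩
      have h2 : s / r < √(1 - t) := Real.lt_sqrt_of_sq_lt (by linarith)
      have h3 : √(1 - t) < 1 := (Real.sqrt_lt' one_pos).2 (by linarith)
      rw [div_lt_iff₀ hr] at h2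
      exact ⟨by linarith, by nlinarith⟩
    · rintro ⟨h0, h1⟩
      have hx : 0 < x := hs.trans_lt h0
      refine ⟨1 - (x / r) ^ 2, ⟨?_, ?_⟩, ?_⟩
      · have : x / r < 1 := (div_lt_one hr).2 h1
        have : 0 < x / r := by positivity
        nlinarith
      · gcongr
      · simp only [sub_sub_cancel]
        rw [Real.sqrt_sq (by positivity)]
        field_simp
  have hlt : ∀ t ∈ Ioo 0 (1 - (s / r) ^ 2), 0 < 1 - t := fun t ht => by
    nlinarith [ht.2, sq_nonneg (s / r)]
  rw [← himg, lintegral_image_eq_lintegral_abs_deriv_mul (f' := fun t => r * (-1 / (2 * √(1 - t))))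
    measurableSet_Ioo, ← lintegral_const_mul' _ _ ENNReal.ofReal_ne_top]
  · refine setLIntegral_congr_fun measurableSet_Ioo fun t ht => ?_
    have h1 := hlt t ht
    have h2 := ht.1
    rw [← ENNReal.ofReal_mul (abs_nonneg _), ← ENNReal.ofReal_mul (by positivity)]
    congr 1
    have e1 : r ^ 2 - (r * √(1 - t)) ^ 2 = r ^ 2 * t := by
      rw [mul_pow, Real.sq_sqrt h1.le]; ring
    rw [e1, Real.mul_rpow (by positivity) h2.le, Real.rpow_add hr, Real.rpow_mul hr.le,
      Real.rpow_neg h1.le, ← Real.sqrt_eq_rpow, abs_mul, abs_of_pos hr, abs_div, abs_neg, abs_one,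
      abs_of_pos (by positivity)]
    simp only [Real.rpow_one, Real.rpow_two]
    field_simp
  · intro t ht
    have h1 := hlt t ht
    exact (((hasDerivAt_id t).const_sub 1).sqrt h1.ne').const_mul r |>.hasDerivWithinAt
  · intro t ht u hu h
    have h1 := hlt t ht
    have h2 := hlt u hu
    have := mul_left_cancel₀ hr.ne' h
    have := (Real.sqrt_inj h1.le h2.le).1 this
    linarith

/-- Orthogonal coordinates whose first axis points along `w`. -/
theorem exists_measurePreserving_norm_sub_sq (n : ℕ) (w : EuclideanSpace ℝ (Fin (n + 1))) :
    ∃ φ : ℝ × (Fin n → ℝ) → EuclideanSpace ℝ (Fin (n + 1)), MeasurePreserving φ ∧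
      (∀ p, ‖φ p‖ ^ 2 = p.1 ^ 2 + ∑ i, p.2 i ^ 2) ∧
      ∀ p, ‖φ p - w‖ ^ 2 = (p.1 - ‖w‖) ^ 2 + ∑ i, p.2 i ^ 2 := by
  obtain ⟨u, hu, hw⟩ : ∃ u : EuclideanSpace ℝ (Fin (n + 1)), ‖u‖ = 1 ∧ w = ‖w‖ • u := by
    rcases eq_or_ne w 0 with rfl | h
    · exact ⟨EuclideanSpace.single 0 1, by simp, by simp⟩
    · exact ⟨‖w‖⁻¹ • w, by simp [norm_smul, h], by simp [smul_smul, h]⟩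
  obtain ⟨b, hb⟩ := Orthonormal.exists_orthonormalBasis_extension_of_card_eq
    (𝕜 := ℝ) (E := EuclideanSpace ℝ (Fin (n + 1))) (ι := Fin (n + 1)) (by simp)
    (v := fun _ => u) (s := {0}) (by
      constructor
      · simp [hu]
      · intro i j hij
        exact absurd (Subsingleton.elim i j) hij)
  have hb0 : b 0 = u := hb 0 rfl
  have hTw : b.repr w = EuclideanSpace.single 0 ‖w‖ := by
    conv_lhs => rw [hw, map_smul, ← hb0, b.repr_self]
    ext i
    simp
  have hφ := (b.repr.symm.measurePreserving.comp (PiLp.volume_preserving_toLp (Fin (n + 1)))).comp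
    (volume_preserving_piFinSuccAbove (fun _ : Fin (n + 1) => ℝ) 0).symm
  refine ⟨_, hφ, fun p => ?_, fun p => ?_⟩
  · simp [EuclideanSpace.norm_sq_eq, Fin.sum_univ_succ]
  · rw [← b.repr.norm_map, map_sub, hTw]
    simp [EuclideanSpace.norm_sq_eq, Fin.sum_univ_succ]

/-- The volume of a lens, sliced orthogonally to the axis of its two centres. -/
theorem volume_ball_inter_ball_eq_lintegral (n : ℕ) {r : ℝ} (hr : 0 ≤ r)
    (w : EuclideanSpace ℝ (Fin (n + 1))) :
    volume (ball 0 r ∩ ball w r) =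
      2 * ∫⁻ x in Ioi (‖w‖ / 2), volume {y : Fin n → ℝ | ∑ i, y i ^ 2 < r ^ 2 - x ^ 2} := by
  obtain ⟨φ, hφ, hφ0, hφw⟩ := exists_measurePreserving_norm_sub_sq n w
  have hmeas : MeasurableSet (ball (0 : EuclideanSpace ℝ (Fin (n + 1))) r ∩ ball w r) :=
    measurableSet_ball.inter measurableSet_ball
  have hslice : ∀ x : ℝ, Prod.mk x ⁻¹' (φ ⁻¹' (ball 0 r ∩ ball w r)) =
      {y : Fin n → ℝ | ∑ i, y i ^ 2 < r ^ 2 - (|x - ‖w‖ / 2| + ‖w‖ / 2) ^ 2} := by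
    intro x
    ext y
    have h0 := norm_nonneg w
    simp only [mem_preimage, mem_inter_iff, mem_ball, dist_eq_norm, sub_zero, mem_ofPred_eq,
      ← sq_lt_sq₀ (norm_nonneg _) hr, hφ0, hφw]
    rcases abs_cases (x - ‖w‖ / 2) with ⟨h, h'⟩ | ⟨h, h'⟩ <;> rw [h]
    · exact ⟨fun H => by nlinarith [H.1], fun H => ⟨by nlinarith, by nlinarith⟩⟩
    · exact ⟨fun H => by nlinarith [H.2], fun H => ⟨by nlinarith, by nlinarith⟩⟩
  rw [← hφ.measure_preimage hmeas.nullMeasurableSet, Measure.volume_eq_prod,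
    Measure.prod_apply (hφ.measurable hmeas)]
  simp_rw [hslice]
  rw [lintegral_sub_right_eq_self (fun x => volume {y : Fin n → ℝ |
      ∑ i, y i ^ 2 < r ^ 2 - (|x| + ‖w‖ / 2) ^ 2}) (‖w‖ / 2),
    lintegral_comp_abs (f := fun x => volume {y : Fin n → ℝ |
      ∑ i, y i ^ 2 < r ^ 2 - (x + ‖w‖ / 2) ^ 2})]
  congr 1
  have := (measurePreserving_add_right (volume : Measure ℝ) (‖w‖ / 2)).setLIntegral_comp_preimage_emb
    (measurableEmbedding_addRight _)
    (fun x => volume {y : Fin n → ℝ | ∑ i, y i ^ 2 < r ^ 2 - x ^ 2}) (Ioi (‖w‖ / 2))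
  simpa using this

/-- The volume of the intersection of two balls of equal radius. -/
theorem volume_ball_inter_ball (n : ℕ) {r : ℝ} (hr : 0 < r)
    (w : EuclideanSpace ℝ (Fin (n + 1))) (hw : ‖w‖ ≤ 2 * r) :
    volume (ball 0 r ∩ ball w r) = volume (ball (0 : EuclideanSpace ℝ (Fin (n + 1))) r) *
      ENNReal.ofReal
        (regIncBeta (1 - (‖w‖ / (2 * r)) ^ 2) ((((n + 1 : ℕ) : ℝ) + 1) / 2) (1 / 2)) := by
  have hμ : 0 ≤ 1 - (‖w‖ / (2 * r)) ^ 2 := by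
    have : ‖w‖ / (2 * r) ≤ 1 := (div_le_one (by positivity)).2 hw
    have : 0 ≤ ‖w‖ / (2 * r) := by positivity
    nlinarith
  have hslice : ∫⁻ x in Ioi (‖w‖ / 2), volume {y : Fin n → ℝ | ∑ i, y i ^ 2 < r ^ 2 - x ^ 2} =
      ENNReal.ofReal (√Real.pi ^ n / Real.Gamma (n / 2 + 1)) *
        ∫⁻ x in Ioo (‖w‖ / 2) r, ENNReal.ofReal ((r ^ 2 - x ^ 2) ^ ((n : ℝ) / 2)) := by
    rw [← lintegral_const_mul' _ _ ENNReal.ofReal_ne_top, ← lintegral_indicator measurableSet_Ioi,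
      ← lintegral_indicator measurableSet_Ioo]
    congr 1 with x
    by_cases hx : ‖w‖ / 2 < x
    · have hx0 : 0 < x := (by positivity : 0 ≤ ‖w‖ / 2).trans_lt hx
      by_cases hxr : x < r
      · rw [indicator_of_mem (by exact hx), indicator_of_mem (by exact ⟨hx, hxr⟩),
          volume_sum_sq_lt n (by nlinarith), ENNReal.ofReal_mul (by positivity)]
      · rw [indicator_of_mem (by exact hx), indicator_of_notMem (fun h => hxr h.2)]
        convert measure_empty
        · ext y
          have : 0 ≤ ∑ i, y i ^ 2 := by positivity
          simp only [mem_ofPred_eq, mem_empty_iff_false, iff_false, not_lt]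
          nlinarith
        · infer_instance
    · rw [indicator_of_notMem (by exact hx), indicator_of_notMem (fun h => hx h.1)]
  have hfin : volume (ball 0 r ∩ ball w r) ≠ ∞ :=
    ((measure_mono inter_subset_left).trans_lt measure_ball_lt_top).ne
  have hint : ∫ t in (0 : ℝ)..(1 - (‖w‖ / (2 * r)) ^ 2),
        t ^ ((n : ℝ) / 2) * (1 - t) ^ (-(1 / 2) : ℝ) =
      (∫⁻ t in Ioo 0 (1 - (‖w‖ / (2 * r)) ^ 2),
        ENNReal.ofReal (t ^ ((n : ℝ) / 2) * (1 - t) ^ (-(1 / 2) : ℝ))).toReal := by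
    rw [intervalIntegral.integral_of_le hμ, integral_Ioc_eq_integral_Ioo]
    refine integral_eq_lintegral_of_nonneg_ae ?_ (by fun_prop)
    filter_upwards [self_mem_ae_restrict measurableSet_Ioo] with t ht
    have : 0 < 1 - t := by nlinarith [ht.2, sq_nonneg (‖w‖ / (2 * r))]
    have := ht.1
    positivity
  have hvol := volume_ball_inter_ball_eq_lintegral n hr.le w
  rw [hslice, lintegral_sub_sq_rpow hr (by positivity), div_div] at hvol
  set J := ∫⁻ t in Ioo 0 (1 - (‖w‖ / (2 * r)) ^ 2),
        ENNReal.ofReal (t ^ ((n : ℝ) / 2) * (1 - t) ^ (-(1 / 2) : ℝ))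
  have hc : 0 < √Real.pi ^ n / Real.Gamma (n / 2 + 1) :=
    div_pos (by positivity) (Real.Gamma_pos_of_pos (by positivity))
  have hc' : 0 < r ^ (2 * ((n : ℝ) / 2) + 1) / 2 := by positivity
  have hJ : J ≠ ∞ := by
    intro h
    apply hfin
    rw [hvol, h, ENNReal.mul_top (by simpa using hc'), ENNReal.mul_top (by simpa using hc),
      ENNReal.mul_top two_ne_zero]
  have e1 : (((n + 1 : ℕ) : ℝ) + 1) / 2 - 1 = n / 2 := by push_cast; ring
  have e2 : (1 / 2 : ℝ) - 1 = -(1 / 2) := by norm_num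
  have e3 : (((n + 1 : ℕ) : ℝ) + 1) / 2 + 1 / 2 = ((n + 1 : ℕ) : ℝ) / 2 + 1 := by push_cast; ring
  have e4 : (((n + 1 : ℕ) : ℝ) + 1) / 2 = n / 2 + 1 := by push_cast; ring
  have e5 : 2 * ((n : ℝ) / 2) + 1 = ((n + 1 : ℕ) : ℝ) := by push_cast; ring
  have hG1 : 0 < Real.Gamma (((n + 1 : ℕ) : ℝ) / 2 + 1) := Real.Gamma_pos_of_pos (by positivity)
  have hG2 : 0 < Real.Gamma ((n : ℝ) / 2 + 1) := Real.Gamma_pos_of_pos (by positivity)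
  rw [hvol, EuclideanSpace.volume_ball, regIncBeta, e1, e2, hint, e3, e4, e5, Fintype.card_fin,
    Real.Gamma_one_half_eq, Real.rpow_natCast]
  conv_lhs => rw [← ENNReal.ofReal_toReal hJ]
  have h2 : (2 : ℝ≥0∞) = ENNReal.ofReal 2 := by simp
  rw [← ENNReal.ofReal_pow hr.le, h2, ← ENNReal.ofReal_mul (by positivity),
    ← ENNReal.ofReal_mul (by positivity), ← ENNReal.ofReal_mul (by positivity),
    ← ENNReal.ofReal_mul (by positivity), ← ENNReal.ofReal_mul (by positivity)]
  congr 1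
  field_simp
  ring

/-- The joint law of two points of a ball, integrated over their difference `w`. -/
theorem prod_restrict_ball_norm_sub_mem (n : ℕ) (r : ℝ) {A : Set ℝ} (hA : MeasurableSet A) :
    ((volume : Measure (EuclideanSpace ℝ (Fin n))).restrict (ball 0 r)).prod
        (volume.restrict (ball 0 r)) {p | ‖p.1 - p.2‖ ∈ A} =
      ∫⁻ w : EuclideanSpace ℝ (Fin n), A.indicator 1 ‖w‖ * volume (ball 0 r ∩ ball w r) := by
  let B : Set (EuclideanSpace ℝ (Fin n)) := ball 0 r
  have hB : MeasurableSet B := measurableSet_ball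
  have hS : MeasurableSet {p : EuclideanSpace ℝ (Fin n) × EuclideanSpace ℝ (Fin n) |
      ‖p.1 - p.2‖ ∈ A} := by
    have : Measurable fun p : EuclideanSpace ℝ (Fin n) × EuclideanSpace ℝ (Fin n) =>
      ‖p.1 - p.2‖ := by fun_prop
    exact this hA
  let F : EuclideanSpace ℝ (Fin n) → EuclideanSpace ℝ (Fin n) → ℝ≥0∞ := fun u w =>
    A.indicator 1 ‖w‖ * (B.indicator 1 u * B.indicator 1 (u - w))
  have h1A : Measurable (A.indicator (1 : ℝ → ℝ≥0∞)) := measurable_one.indicator hA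
  have h1B : Measurable (B.indicator (1 : EuclideanSpace ℝ (Fin n) → ℝ≥0∞)) :=
    measurable_one.indicator hB
  have hF : Measurable (Function.uncurry F) := by
    simp only [Function.uncurry_def, F]
    fun_prop
  calc
    _ = ∫⁻ u, ∫⁻ v, F u (u - v) := by
      rw [Measure.prod_restrict, Measure.restrict_apply hS,
        Measure.prod_apply (hS.inter (hB.prod hB))]
      congr 1 with u
      rw [← lintegral_indicator_one (measurable_prodMk_left (hS.inter (hB.prod hB)))]
      congr 1 with v
      by_cases h1 : ‖u - v‖ ∈ A <;> by_cases h2 : u ∈ B <;> by_cases h3 : v ∈ B <;>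
        simp [F, indicator, h1, h2, h3, B] <;> simp_all [B]
    _ = ∫⁻ u, ∫⁻ w, F u w := by
      congr 1 with u
      exact lintegral_sub_left_eq_self (F u) u
    _ = ∫⁻ w, ∫⁻ u, F u w := lintegral_lintegral_swap hF.aemeasurable
    _ = _ := by
      congr 1 with w
      simp only [F]
      rw [lintegral_const_mul _ (by fun_prop),
        ← lintegral_indicator_one (measurableSet_ball.inter measurableSet_ball)]
      congr 2 with u
      by_cases h1 : ‖u‖ < r <;> by_cases h2 : ‖u - w‖ < r <;>
        simp [B, indicator, dist_eq_norm, h1, h2]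

/-- If `U`, `V` are independent and uniformly distributed on the ball of radius `r` in `ℝ^d`,
then the distance `‖U − V‖` has density
`ψ(ρ) = d ρ^{d−1} r^{−d} I_{1−(ρ/2r)²}((d+1)/2, 1/2)` on `[0, 2r]` (and `0` outside). -/
theorem ball_distance_density
    {Ω : Type*} [MeasureSpace Ω] [IsProbabilityMeasure (ℙ : Measure Ω)]
    (d : ℕ) (hd : 0 < d) (r : ℝ) (hr : 0 < r)
    (U V : Ω → EuclideanSpace ℝ (Fin d))
    (hUV : IndepFun U V ℙ)
    (hU : Measure.map U ℙ
      = (volume (Metric.ball (0 : EuclideanSpace ℝ (Fin d)) r))⁻¹ •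
          volume.restrict (Metric.ball (0 : EuclideanSpace ℝ (Fin d)) r))
    (hV : Measure.map V ℙ
      = (volume (Metric.ball (0 : EuclideanSpace ℝ (Fin d)) r))⁻¹ •
          volume.restrict (Metric.ball (0 : EuclideanSpace ℝ (Fin d)) r)) :
    Measure.map (fun ω => ‖U ω - V ω‖) ℙ
      = volume.withDensity (fun ρ => ENNReal.ofReal
          (if ρ ∈ Set.Icc (0 : ℝ) (2 * r) then
            d * ρ ^ (d - 1) * r ^ (-(d : ℝ)) *
              regIncBeta (1 - (ρ / (2 * r)) ^ 2) (((d : ℝ) + 1) / 2) (1 / 2)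
          else 0)) := by
  obtain ⟨n, rfl⟩ := Nat.exists_eq_add_of_le' hd
  set B : Set (EuclideanSpace ℝ (Fin (n + 1))) := ball 0 r with hB
  have hB0 : volume B ≠ 0 := (measure_ball_pos _ _ hr).ne'
  have hBtop : volume B ≠ ∞ := measure_ball_lt_top.ne
  have hne : (volume B)⁻¹ • (volume : Measure (EuclideanSpace ℝ (Fin (n + 1)))).restrict B ≠ 0 := by
    intro h
    have := congrArg (fun m : Measure _ => m univ) h
    simp [hB0, hBtop] at this
  have hUm : AEMeasurable U ℙ := .of_map_ne_zero (by rwa [hU])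
  have hVm : AEMeasurable V ℙ := .of_map_ne_zero (by rwa [hV])
  have hprod := hUV.map_prod_eq_prod_map_map hUm hVm
  let e : EuclideanSpace ℝ (Fin (n + 1)) := EuclideanSpace.single 0 1
  have he : ‖e‖ = 1 := by simp [e]
  let G : ℝ → ℝ≥0∞ := fun ρ => volume (ball 0 r ∩ ball (ρ • e) r)
  have hG : Measurable G := by
    have h1 : IsOpen {p : ℝ × EuclideanSpace ℝ (Fin (n + 1)) | dist p.2 0 < r} :=
      isOpen_lt (by fun_prop) (by fun_prop)
    have h2 : IsOpen {p : ℝ × EuclideanSpace ℝ (Fin (n + 1)) | dist p.2 (p.1 • e) < r} :=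
      isOpen_lt (by fun_prop) (by fun_prop)
    exact measurable_measure_prodMk_left (h1.inter h2).measurableSet
  have hGnorm : ∀ w : EuclideanSpace ℝ (Fin (n + 1)), volume (ball 0 r ∩ ball w r) = G ‖w‖ := by
    intro w
    simp only [G]
    rw [volume_ball_inter_ball_eq_lintegral n hr.le, volume_ball_inter_ball_eq_lintegral n hr.le,
      norm_smul, he, norm_norm, mul_one]
  have hvolB : volume B = ENNReal.ofReal (r ^ (n + 1)) *
      volume (ball (0 : EuclideanSpace ℝ (Fin (n + 1))) 1) := by
    simpa using Measure.addHaar_ball (volume : Measure (EuclideanSpace ℝ (Fin (n + 1)))) 0 hr.le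
  have hβ0 : volume (ball (0 : EuclideanSpace ℝ (Fin (n + 1))) 1) ≠ 0 :=
    (measure_ball_pos _ _ one_pos).ne'
  have hβtop : volume (ball (0 : EuclideanSpace ℝ (Fin (n + 1))) 1) ≠ ∞ := measure_ball_lt_top.ne
  ext A hA
  have hsub : Measurable fun p : EuclideanSpace ℝ (Fin (n + 1)) × EuclideanSpace ℝ (Fin (n + 1)) =>
      ‖p.1 - p.2‖ := by fun_prop
  have hmap : Measure.map (fun ω => ‖U ω - V ω‖) ℙ =
      ((Measure.map U ℙ).prod (Measure.map V ℙ)).map fun p => ‖p.1 - p.2‖ := by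
    rw [← hprod, AEMeasurable.map_map_of_aemeasurable hsub.aemeasurable (hUm.prodMk hVm)]
    rfl
  rw [hmap, Measure.map_apply hsub hA, hU, hV, Measure.prod_smul_left, Measure.prod_smul_right,
    withDensity_apply _ hA, Measure.smul_apply, Measure.smul_apply]
  change _ • _ • ((volume.restrict B).prod (volume.restrict B)) {p | ‖p.1 - p.2‖ ∈ A} = _
  rw [prod_restrict_ball_norm_sub_mem _ _ hA]
  simp_rw [hGnorm]
  rw [lintegral_fun_norm_addHaar volume (f := fun ρ => A.indicator 1 ρ * G ρ)
    ((measurable_one.indicator hA).mul hG), smul_eq_mul, smul_eq_mul, ← mul_assoc, ← mul_assoc,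
    ← lintegral_const_mul' _ _ (by finiteness), ← lintegral_indicator measurableSet_Ioi,
    ← lintegral_indicator hA]
  refine lintegral_congr_ae ?_
  filter_upwards [Measure.ae_ne volume (0 : ℝ)] with ρ hρ
  by_cases hρA : ρ ∈ A
  swap
  · simp [hρA, indicator]
  rcases hρ.lt_or_gt with hneg | hpos
  · rw [indicator_of_notMem (by simpa using hneg.le), indicator_of_mem hρA,
      if_neg (fun h => hneg.not_ge h.1), ENNReal.ofReal_zero]
  rw [indicator_of_mem (by exact hpos), indicator_of_mem hρA, indicator_of_mem hρA]
  simp only [finrank_euclideanSpace, Fintype.card_fin, Pi.one_apply, one_mul]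
  have hnorm : ‖ρ • e‖ = ρ := by rw [norm_smul, he, mul_one, Real.norm_of_nonneg hpos.le]
  by_cases hle : ρ ≤ 2 * r
  · rw [if_pos ⟨hpos.le, hle⟩]
    simp only [G]
    rw [volume_ball_inter_ball n hr _ (by rwa [hnorm]), hnorm, ← hB]
    have hK : (volume B)⁻¹ * volume (ball (0 : EuclideanSpace ℝ (Fin (n + 1))) 1) =
        ENNReal.ofReal (r ^ (-((n + 1 : ℕ) : ℝ))) := by
      rw [Real.rpow_neg hr.le, Real.rpow_natCast, ENNReal.ofReal_inv_of_pos (by positivity), hvolB,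
        ENNReal.mul_inv (.inr hβtop) (.inr hβ0), mul_assoc, ENNReal.inv_mul_cancel hβ0 hβtop,
        mul_one]
    have hK' : (volume B)⁻¹ * volume B = 1 := ENNReal.inv_mul_cancel hB0 hBtop
    rw [ENNReal.ofReal_mul (by positivity), ENNReal.ofReal_mul (by positivity),
      ENNReal.ofReal_mul (by positivity), ENNReal.ofReal_natCast, ← hK, add_tsub_cancel_right]
    set I := ENNReal.ofReal (regIncBeta _ _ _)
    set β := volume (ball (0 : EuclideanSpace ℝ (Fin (n + 1))) 1)
    calc
      _ = ((volume B)⁻¹ * volume B) *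
          (((n + 1 : ℕ) : ℝ≥0∞) * ENNReal.ofReal (ρ ^ n) * ((volume B)⁻¹ * β) * I) := by ring
      _ = _ := by rw [hK', one_mul]
  · rw [if_neg (fun h => hle h.2), ENNReal.ofReal_zero]
    have : G ρ = 0 := by
      simp only [G]
      rw [(ball_disjoint_ball (by rw [dist_zero_left, hnorm]; linarith)).inter_eq, measure_empty]
    rw [this, mul_zero, mul_zero]
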